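/- arXiv:2104.12057 — 2 statements merged into one kernel-verified Lean document; each statement's English description precedes it below -/
import Mathlib

section
/- Let T be an alternating base tree for (G, M, f) and k ≥ 0. Then for every θ ∈ {0,1} and every node v with r^θ_G(f,v) ≤ k+1, the shortest θ-alternating distance is preserved in G_k, i.e., r^θ_{G_k}(f,v) = r^θ_G(f,v). -/
namespace MM

open SimpleGraph

variable {V : Type*}

/-- `M` is a matching of `G`: a set of edges of `G` no two of which share an endpoint. -/
def IsMatching (G : SimpleGraph V) (M : Set (Sym2 V)) : Prop :=
  M ⊆ G.edgeSet ∧ ∀ e ∈ M, ∀ e' ∈ M, ∀ v : V, v ∈ e → v ∈ e' → e = e'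

/-- A node is matched if it is an endpoint of an edge of `M`. -/
def Matched (M : Set (Sym2 V)) (v : V) : Prop :=
  ∃ e ∈ M, v ∈ e

/-- A list of edges alternates w.r.t. `M`: for consecutive edges, exactly one belongs to `M`. -/
def AltList (M : Set (Sym2 V)) (l : List (Sym2 V)) : Prop :=
  ∀ (i : ℕ) (h : i + 1 < l.length),
    (l.get ⟨i, Nat.lt_of_succ_lt h⟩ ∈ M ↔ l.get ⟨i + 1, h⟩ ∉ M)

/-- An alternating path: a simple path whose edges alternate w.r.t. `M`. -/
def IsAltPath {G : SimpleGraph V} (M : Set (Sym2 V)) {u v : V} (p : G.Walk u v) : Prop :=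
  p.IsPath ∧ AltList M p.edges

/-- An augmenting path: an alternating path whose two (distinct) endpoints are unmatched. -/
def IsAugPath (G : SimpleGraph V) (M : Set (Sym2 V)) {u v : V} (p : G.Walk u v) : Prop :=
  IsAltPath M p ∧ u ≠ v ∧ ¬ Matched M u ∧ ¬ Matched M v

/-- `v` is `θ`-reachable from `f` in `H`: there is a `θ`-alternating path from `f` to `v`. -/
def ThetaReach (H : SimpleGraph V) (M : Set (Sym2 V)) (θ : ℕ) (f v : V) : Prop :=
  ∃ p : H.Walk f v, IsAltPath M p ∧ p.length % 2 = θ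

/-- `r^θ_H(f,v)`: the minimum length of a `θ`-alternating path from `f` to `v` in `H`
(`⊤` if none exists). -/
noncomputable def rAlt (H : SimpleGraph V) (M : Set (Sym2 V)) (θ : ℕ) (f v : V) : ℕ∞ :=
  sInf {n : ℕ∞ | ∃ p : H.Walk f v, IsAltPath M p ∧ p.length % 2 = θ ∧ (p.length : ℕ∞) = n}

/-- `r_H(f,v) = min(r^0_H(f,v), r^1_H(f,v))`. -/
noncomputable def rMin (H : SimpleGraph V) (M : Set (Sym2 V)) (f v : V) : ℕ∞ :=
  min (rAlt H M 0 f v) (rAlt H M 1 f v)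

open Classical in
/-- `γ(v)`: the parity achieving the minimum of `r^θ_G(f,v)`. -/
noncomputable def gam (G : SimpleGraph V) (M : Set (Sym2 V)) (f v : V) : ℕ :=
  if rAlt G M 0 f v ≤ rAlt G M 1 f v then 0 else 1

/-- An alternating base tree for `(G, M, f)`: a spanning tree `T` of `G` rooted at `f`
(with parent function `par`) such that the edge from each `v ≠ f` to its parent is the
last edge of a shortest alternating path from `f` to `v` in `G`. -/
structure AltBaseTree (G : SimpleGraph V) (M : Set (Sym2 V)) (f : V)
    (T : SimpleGraph V) (par : V → V) : Prop where
  le : T ≤ G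
  tree : T.IsTree
  adj : ∀ v, v ≠ f → T.Adj v (par v)
  parent_dist : ∀ v, v ≠ f → T.dist f v = T.dist f (par v) + 1
  r_eq : ∀ v, v ≠ f →
    rAlt G M (gam G M f v) f v = rAlt G M (1 - gam G M f v) f (par v) + 1
  edge_mem : ∀ v, v ≠ f → (s(v, par v) ∈ M ↔ gam G M f v = 0)

/-- `c` is an ancestor of `x` in the tree `T` rooted at `f` (equivalently, for
`isAnc T f v w`: `w` belongs to the subtree `T_v`). -/
def isAnc (T : SimpleGraph V) (f c x : V) : Prop :=
  T.dist f c + T.dist c x = T.dist f x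

/-- The level-`k` edge set `F_k`. -/
def levelSet (G : SimpleGraph V) (M : Set (Sym2 V)) (f : V) (k : ℕ) : Set (Sym2 V) :=
  {e | e ∈ G.edgeSet ∧ ∃ u w : V, e = s(u, w) ∧
    ((e ∉ M ∧ max (rAlt G M 0 f u) (rAlt G M 0 f w) = (k : ℕ∞)) ∨
     (e ∈ M ∧ max (rAlt G M 1 f u) (rAlt G M 1 f w) = (k : ℕ∞)))}

/-- `F_{≤ k} = ⋃_{1 ≤ i ≤ k} F_i`. -/
def levelLe (G : SimpleGraph V) (M : Set (Sym2 V)) (f : V) (k : ℕ) : Set (Sym2 V) :=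
  {e | ∃ i, 1 ≤ i ∧ i ≤ k ∧ e ∈ levelSet G M f i}

/-- `G_k`: the spanning subgraph of `G` with edge set `E(T) ∪ F_{≤k}`. -/
def graphAt (T G : SimpleGraph V) (M : Set (Sym2 V)) (f : V) (k : ℕ) : SimpleGraph V :=
  SimpleGraph.fromEdgeSet (T.edgeSet ∪ levelLe G M f k)

/-- `B_k`: the set of bridges of `G_k`. -/
def Bset (T G : SimpleGraph V) (M : Set (Sym2 V)) (f : V) (k : ℕ) : Set (Sym2 V) :=
  {e | (graphAt T G M f k).IsBridge e}

/-- The edge set of the cycle `cyc(e)` formed by the non-tree edge `e = (u,w)` together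
with the path in `T` between `u` and `w`. -/
def cycEdges (T : SimpleGraph V) (u w : V) : Set (Sym2 V) :=
  insert s(u, w) {e | ∃ p : T.Walk u w, p.IsPath ∧ e ∈ p.edges}

/-- The `i`-th edge of `l` belongs to `M` exactly when `i + t` is odd. -/
def AltFrom (M : Set (Sym2 V)) (t : ℕ) (l : List (Sym2 V)) : Prop :=
  ∀ (i : ℕ) (h : i < l.length), l[i] ∈ M ↔ (i + t) % 2 = 1

namespace AltFrom

variable {M : Set (Sym2 V)} {s t : ℕ} {l l₁ l₂ : List (Sym2 V)}

theorem congr_mod (h : AltFrom M t l) (hst : t % 2 = s % 2) : AltFrom M s l := by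
  intro i hi
  rw [h i hi]
  omega

theorem append (h₁ : AltFrom M t l₁) (h₂ : AltFrom M (t + l₁.length) l₂) :
    AltFrom M t (l₁ ++ l₂) := by
  intro i hi
  rw [List.length_append] at hi
  by_cases hlt : i < l₁.length
  · rw [List.getElem_append_left hlt]
    exact h₁ i hlt
  · rw [List.getElem_append_right (by omega), h₂ _ (by omega)]
    omega

theorem left (h : AltFrom M t (l₁ ++ l₂)) : AltFrom M t l₁ := by
  intro i hi
  rw [← h i (by rw [List.length_append]; omega), List.getElem_append_left hi]

theorem right (h : AltFrom M t (l₁ ++ l₂)) : AltFrom M (t + l₁.length) l₂ := by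
  intro i hi
  have h' := h (l₁.length + i) (by rw [List.length_append]; omega)
  rw [List.getElem_append_right (by omega)] at h'
  simp only [Nat.add_sub_cancel_left] at h'
  rw [h']
  omega

theorem reverse (h : AltFrom M t l) : AltFrom M (t + l.length + 1) l.reverse := by
  intro i hi
  rw [List.length_reverse] at hi
  rw [List.getElem_reverse, h _ (by omega)]
  omega

theorem altList (h : AltFrom M t l) : AltList M l := by
  intro i hi
  simp only [List.get_eq_getElem]
  rw [h i (by omega), h (i + 1) hi]
  omega

end AltFrom

theorem altFrom_zero_of_altList {G : SimpleGraph V} {M : Set (Sym2 V)} {f v : V}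
    (hf : ¬ Matched M f) (p : G.Walk f v) (h : AltList M p.edges) : AltFrom M 0 p.edges := by
  intro i
  induction i with
  | zero =>
    intro hi
    cases p with
    | nil => simp at hi
    | cons hadj q =>
      simp only [Walk.edges_cons, List.getElem_cons_zero]
      refine iff_of_false (fun hmem => hf ⟨_, hmem, Sym2.mem_mk_left _ _⟩) (by omega)
  | succ i ih =>
    intro hi
    have h1 := h i hi
    simp only [List.get_eq_getElem] at h1
    have h2 := ih (by omega)
    by_cases hm : p.edges[i + 1] ∈ M
    · have h3 : ¬ (i + 0) % 2 = 1 := fun h4 => (h1.1 (h2.2 h4)) hm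
      exact iff_of_true hm (by omega)
    · have h3 := h2.1 (h1.2 hm)
      exact iff_of_false hm (by omega)

theorem isAltPath_iff {G : SimpleGraph V} {M : Set (Sym2 V)} {f v : V}
    (hf : ¬ Matched M f) (p : G.Walk f v) :
    IsAltPath M p ↔ p.IsPath ∧ AltFrom M 0 p.edges :=
  ⟨fun h => ⟨h.1, altFrom_zero_of_altList hf p h.2⟩, fun h => ⟨h.1, h.2.altList⟩⟩

theorem isPath_append_of_disjoint {G : SimpleGraph V} {u v w : V} {p : G.Walk u v}
    {q : G.Walk v w} (hp : p.IsPath) (hq : q.IsPath)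
    (h : ∀ x ∈ p.support, x ∈ q.support → x = v) : (p.append q).IsPath := by
  rw [Walk.isPath_def, Walk.support_append, List.nodup_append']
  have hq' := hq.support_nodup
  rw [← Walk.cons_tail_support] at hq'
  refine ⟨hp.support_nodup, (List.nodup_cons.1 hq').2, ?_⟩
  intro x hx hx'
  have := h x hx (List.mem_of_mem_tail hx')
  subst this
  exact (List.nodup_cons.1 hq').1 hx'

/-- A walk meeting `S` can be cut at its first vertex in `S`. -/
theorem exists_append_first_mem {G : SimpleGraph V} {u v : V} (S : Set V) (p : G.Walk u v)
    (h : ∃ x ∈ p.support, x ∈ S) :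
    ∃ x ∈ S, ∃ (q : G.Walk u x) (r : G.Walk x v), p = q.append r ∧
      ∀ y ∈ q.support, y ∈ S → y = x := by
  induction p with
  | nil =>
    obtain ⟨x, hx, hxS⟩ := h
    rw [Walk.support_nil, List.mem_singleton] at hx
    subst hx
    exact ⟨x, hxS, Walk.nil, Walk.nil, rfl, by simp⟩
  | @cons a b c hadj p ih =>
    by_cases ha : a ∈ S
    · exact ⟨a, ha, Walk.nil, Walk.cons hadj p, rfl, by simp⟩
    · obtain ⟨x, hx, hxS⟩ := h
      rw [Walk.support_cons, List.mem_cons] at hx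
      have hx' : x ∈ p.support := by
        rcases hx with rfl | hx
        · exact absurd hxS ha
        · exact hx
      obtain ⟨z, hz, q, r, rfl, hq⟩ := ih ⟨x, hx', hxS⟩
      refine ⟨z, hz, Walk.cons hadj q, r, rfl, ?_⟩
      intro y hy hyS
      rw [Walk.support_cons, List.mem_cons] at hy
      rcases hy with rfl | hy
      · exact absurd hyS ha
      · exact hq y hy hyS

/-- The prefix `A` of a shortest alternating path `A.append B` may be replaced by any alternating
path `Q` of the same parity that is not longer, provided that every alternating path of the other
parity to the end of `A` is at least as long as `A.append B`. -/
theorem isPath_append_of_shortest {G : SimpleGraph V} {M : Set (Sym2 V)} {f w v : V}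
    {A : G.Walk f w} {B : G.Walk w v} {Q : G.Walk f w}
    (hP : (A.append B).IsPath) (hPM : AltFrom M 0 (A.append B).edges)
    (hQ : Q.IsPath) (hQM : AltFrom M 0 Q.edges)
    (hle : Q.length ≤ A.length)
    (hmin : ∀ R : G.Walk f v, R.IsPath → AltFrom M 0 R.edges →
      R.length % 2 = (A.append B).length % 2 → (A.append B).length ≤ R.length)
    (hother : ∀ R : G.Walk f w, R.IsPath → AltFrom M 0 R.edges →
      R.length % 2 ≠ A.length % 2 → (A.append B).length ≤ R.length) :
    (Q.append B).IsPath := by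
  classical
  refine isPath_append_of_disjoint hQ hP.of_append_right ?_
  by_contra! hcon
  obtain ⟨y, hyQ, hyB, hyw⟩ := hcon
  obtain ⟨x, ⟨hxB, hxw⟩, Q₁, Q₂, rfl, hfirst⟩ :=
    exists_append_first_mem {z | z ∈ B.support ∧ z ≠ w} Q ⟨y, hyQ, hyB, hyw⟩
  have hQ₂ : Q₂.length ≠ 0 := fun h => hxw (Walk.eq_of_length_eq_zero h)
  have hwQ₁ : w ∉ Q₁.support := by
    intro hw
    have hnd := hQ.support_nodup
    rw [Walk.support_append, List.nodup_append'] at hnd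
    refine hnd.2.2 hw ?_
    have hend := Q₂.end_mem_support
    rw [← Walk.cons_tail_support, List.mem_cons] at hend
    exact hend.resolve_left (fun h => hxw h.symm)
  obtain ⟨B₁, B₂, rfl⟩ : ∃ (B₁ : G.Walk w x) (B₂ : G.Walk x v), B = B₁.append B₂ :=
    ⟨_, _, (B.take_spec hxB).symm⟩
  have hB := hP.of_append_right
  have hdisj : ∀ z ∈ Q₁.support, z ∈ (B₁.append B₂).support → z = x := by
    intro z hz hzB
    refine hfirst z hz ⟨hzB, ?_⟩
    rintro rfl
    exact hwQ₁ hz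
  rw [Walk.edges_append] at hPM hQM
  have hBM := hPM.right
  rw [Walk.edges_append] at hBM
  simp only [Walk.length_append, Walk.length_edges] at *
  by_cases hpar : Q₁.length % 2 = (A.length + B₁.length) % 2
  · have := hmin (Q₁.append B₂)
      (isPath_append_of_disjoint hQ.of_append_left hB.of_append_right
        (fun z hz hz' => hdisj z hz (by rw [Walk.mem_support_append_iff]; exact Or.inr hz')))
      (by
        rw [Walk.edges_append]
        refine hQM.left.append (hBM.right.congr_mod ?_)
        simp only [Walk.length_edges]
        omega)
      (by rw [Walk.length_append]; omega)
    rw [Walk.length_append] at this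
    omega
  · have := hother (Q₁.append B₁.reverse)
      (isPath_append_of_disjoint hQ.of_append_left hB.of_append_left.reverse
        (fun z hz hz' => hdisj z hz (by
          rw [Walk.mem_support_append_iff]
          rw [Walk.support_reverse, List.mem_reverse] at hz'
          exact Or.inl hz')))
      (by
        rw [Walk.edges_append, Walk.edges_reverse]
        refine hQM.left.append (hBM.left.reverse.congr_mod ?_)
        simp only [Walk.length_edges]
        omega)
      (by rw [Walk.length_append, Walk.length_reverse]; omega)
    rw [Walk.length_append, Walk.length_reverse] at this
    omega

section Distances

variable {G : SimpleGraph V} {M : Set (Sym2 V)} {f v : V} {θ : ℕ}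

theorem rAlt_le {p : G.Walk f v} (hp : IsAltPath M p) (hθ : p.length % 2 = θ) :
    rAlt G M θ f v ≤ p.length :=
  sInf_le ⟨p, hp, hθ, rfl⟩

theorem exists_walk_of_rAlt_ne_top (h : rAlt G M θ f v ≠ ⊤) :
    ∃ p : G.Walk f v, IsAltPath M p ∧ p.length % 2 = θ ∧ (p.length : ℕ∞) = rAlt G M θ f v := by
  have hne : {n : ℕ∞ | ∃ p : G.Walk f v, IsAltPath M p ∧ p.length % 2 = θ ∧
      (p.length : ℕ∞) = n}.Nonempty := by
    by_contra hemp
    rw [Set.not_nonempty_iff_eq_empty] at hemp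
    exact h (by rw [rAlt, hemp, sInf_empty])
  exact csInf_mem hne

theorem rAlt_anti {H : SimpleGraph V} (hle : H ≤ G) : rAlt G M θ f v ≤ rAlt H M θ f v := by
  refine le_sInf ?_
  rintro n ⟨p, hp, hθ, rfl⟩
  rw [← Walk.length_mapLe hle p] at hθ ⊢
  refine rAlt_le ⟨?_, ?_⟩ hθ
  · exact hp.1.mapLe hle
  · rw [Walk.edges_mapLe_eq_edges]
    exact hp.2

theorem gam_eq_of_rAlt_le {t : ℕ} (ht : t ≤ 1) (hlt : rAlt G M t f v < ⊤)
    (h : rAlt G M t f v ≤ rAlt G M (1 - t) f v) : gam G M f v = t := by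
  unfold gam
  interval_cases t
  · exact if_pos h
  · refine if_neg fun h' => ?_
    have heq := le_antisymm h h'
    obtain ⟨p, -, hp, hpl⟩ := exists_walk_of_rAlt_ne_top hlt.ne
    obtain ⟨q, -, hq, hql⟩ := exists_walk_of_rAlt_ne_top (heq ▸ hlt).ne
    have : (p.length : ℕ∞) = q.length := by rw [hpl, hql, heq]
    have := Nat.cast_injective this
    omega

end Distances

theorem graphAt_le {T G : SimpleGraph V} {M : Set (Sym2 V)} {f : V} {k : ℕ} (hT : T ≤ G) :
    graphAt T G M f k ≤ G := by
  intro a b hab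
  rw [graphAt, fromEdgeSet_adj] at hab
  rcases hab.1 with h | ⟨i, -, -, h, -⟩
  · exact hT h
  · exact h

/-- An edge outside `G_k` whose `u`-side distance is at most `k` has `w`-side distance
exceeding `k`. -/
theorem lt_rAlt_of_not_adj_graphAt {T G : SimpleGraph V} {M : Set (Sym2 V)} {f u w : V}
    {k t : ℕ} (hadj : G.Adj u w) (hwf : w ≠ f) (ht : t ≤ 1) (hM : s(u, w) ∈ M ↔ t = 1)
    (hu : rAlt G M t f u ≤ k) (hnot : ¬ (graphAt T G M f k).Adj u w) :
    (k : ℕ∞) < rAlt G M t f w := by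
  by_contra! hw
  obtain ⟨m, hm⟩ := ENat.ne_top_iff_exists.1
    (ne_top_of_le_ne_top (ENat.natCast_ne_top k) (max_le hu hw))
  have hmk : m ≤ k := by
    have := max_le hu hw
    rw [← hm] at this
    exact_mod_cast this
  have hm1 : 1 ≤ m := by
    by_contra! h0
    obtain rfl : m = 0 := by omega
    have h0 : rAlt G M t f w = 0 := by
      have := le_max_right (rAlt G M t f u) (rAlt G M t f w)
      rw [← hm] at this
      simpa using this
    obtain ⟨p, -, -, hp⟩ := exists_walk_of_rAlt_ne_top (by rw [h0]; simp)
    rw [h0] at hp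
    exact hwf (Walk.eq_of_length_eq_zero (p := p) (by exact_mod_cast hp)).symm
  refine hnot ?_
  rw [graphAt, fromEdgeSet_adj]
  refine ⟨Or.inr ⟨m, hm1, hmk, hadj, u, w, rfl, ?_⟩, hadj.ne⟩
  interval_cases t
  · exact Or.inl ⟨by simp [hM], hm.symm⟩
  · exact Or.inr ⟨by simp [hM], hm.symm⟩

/-- The last edge of a non-trivial alternating path lies in `M` iff the length is even. -/
theorem AltFrom.mem_of_concat {G : SimpleGraph V} {M : Set (Sym2 V)} {f u w : V}
    {p : G.Walk f u} {h : G.Adj u w} (hp : AltFrom M 0 (p.concat h).edges) :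
    s(u, w) ∈ M ↔ p.length % 2 = 1 := by
  have := hp p.length (by simp)
  simpa [Walk.edges_concat] using this

theorem AltFrom.concat {G : SimpleGraph V} {M : Set (Sym2 V)} {f u w : V}
    {p : G.Walk f u} {h : G.Adj u w} (hp : AltFrom M 0 p.edges)
    (hM : s(u, w) ∈ M ↔ p.length % 2 = 1) : AltFrom M 0 (p.concat h).edges := by
  rw [Walk.edges_concat, List.concat_eq_append]
  refine hp.append ?_
  intro i hi
  obtain rfl : i = 0 := by simpa using hi
  simpa using hM

/-- If `w` is reached by an alternating path `A` while its distance for the other parity exceeds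
`k`, then extending a path in `G_k` to the parent of `w` yields an alternating path to `w` in `G_k`
of the same parity as `A` and no longer than `A`. -/
theorem exists_walk_through_parent {G : SimpleGraph V} {M : Set (Sym2 V)} {f : V}
    (hf : ¬ Matched M f) {T : SimpleGraph V} {par : V → V} (habt : AltBaseTree G M f T par)
    {k n : ℕ} (hn : n ≤ k + 1)
    (ih : ∀ m < n, ∀ (x : V) (P : G.Walk f x), P.IsPath → AltFrom M 0 P.edges → P.length = m →
      (∀ R : G.Walk f x, R.IsPath → AltFrom M 0 R.edges →
        R.length % 2 = P.length % 2 → P.length ≤ R.length) →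
      ∃ P' : G.Walk f x, P'.IsPath ∧ AltFrom M 0 P'.edges ∧ P'.length = P.length ∧
        ∀ e ∈ P'.edges, e ∈ (graphAt T G M f k).edgeSet)
    {w : V} (hwf : w ≠ f) {A : G.Walk f w} (hA : A.IsPath) (hAM : AltFrom M 0 A.edges)
    (hAn : A.length ≤ n)
    (hother : (k : ℕ∞) < rAlt G M (1 - A.length % 2) f w) :
    ∃ Q : G.Walk f w, Q.IsPath ∧ AltFrom M 0 Q.edges ∧ Q.length ≤ A.length ∧
      Q.length % 2 = A.length % 2 ∧ ∀ e ∈ Q.edges, e ∈ (graphAt T G M f k).edgeSet := by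
  classical
  set t := A.length % 2 with ht
  have ht1 : t ≤ 1 := by omega
  have hrA : rAlt G M t f w ≤ A.length := rAlt_le ((isAltPath_iff hf A).2 ⟨hA, hAM⟩) rfl
  have hother' : ((k + 1 : ℕ) : ℕ∞) ≤ rAlt G M (1 - t) f w := by
    push_cast
    exact Order.add_one_le_of_lt hother
  have hgam : gam G M f w = t :=
    gam_eq_of_rAlt_le ht1 (hrA.trans_lt (ENat.natCast_lt_top _))
      (hrA.trans (le_trans (by exact_mod_cast hAn.trans hn) hother'))
  have hr := habt.r_eq w hwf
  have hmem := habt.edge_mem w hwf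
  have hTadj := habt.adj w hwf
  rw [hgam] at hr hmem
  obtain ⟨q, hq, hqt, hql⟩ := exists_walk_of_rAlt_ne_top (G := G) (M := M) (θ := 1 - t) (f := f)
    (v := par w) (by
      intro htop
      rw [htop, top_add] at hr
      rw [hr] at hrA
      exact absurd hrA (by simp))
  rw [← hql] at hr
  rw [hr] at hrA
  have hqA : q.length + 1 ≤ A.length := by exact_mod_cast hrA
  rw [isAltPath_iff hf] at hq
  obtain ⟨Q, hQ, hQM, hQl, hQE⟩ := ih q.length (by omega) (par w) q hq.1 hq.2 rfl (by
    intro R hR hRM hRpar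
    have := rAlt_le ((isAltPath_iff hf R).2 ⟨hR, hRM⟩) rfl
    rw [hRpar, hqt, ← hql] at this
    exact_mod_cast this)
  have hwQ : w ∉ Q.support := by
    intro hw
    have hspec := Q.take_spec hw
    have hlen := congrArg Walk.length hspec
    rw [Walk.length_append] at hlen
    have htake : IsAltPath M (Q.takeUntil w hw) := by
      rw [isAltPath_iff hf]
      refine ⟨hQ.takeUntil hw, ?_⟩
      rw [← hspec, Walk.edges_append] at hQM
      exact hQM.left
    have hle := rAlt_le htake rfl
    by_cases hpar : (Q.takeUntil w hw).length % 2 = t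
    · rw [hpar, hr] at hle
      have : q.length + 1 ≤ (Q.takeUntil w hw).length := by exact_mod_cast hle
      omega
    · have hpar' : (Q.takeUntil w hw).length % 2 = 1 - t := by omega
      rw [hpar'] at hle
      have : k + 1 ≤ (Q.takeUntil w hw).length := by exact_mod_cast hother'.trans hle
      omega
  refine ⟨Q.concat (habt.le hTadj.symm), hQ.concat hwQ _, hQM.concat ?_, ?_, ?_, ?_⟩
  · rw [Sym2.eq_swap, hmem]
    omega
  · rw [Walk.length_concat]
    omega
  · rw [Walk.length_concat]
    omega
  · intro e he
    rw [Walk.edges_concat, List.concat_eq_append, List.mem_append, List.mem_singleton] at he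
    rcases he with he | rfl
    · exact hQE e he
    · rw [mem_edgeSet, graphAt, fromEdgeSet_adj]
      exact ⟨Or.inl hTadj.symm, hTadj.ne'⟩

theorem exists_shortest_in_graphAt {G : SimpleGraph V} {M : Set (Sym2 V)} {f : V}
    (hf : ¬ Matched M f) {T : SimpleGraph V} {par : V → V} (habt : AltBaseTree G M f T par)
    {k : ℕ} (n : ℕ) : n ≤ k + 1 → ∀ (v : V) (P : G.Walk f v), P.IsPath → AltFrom M 0 P.edges →
      P.length = n →
      (∀ R : G.Walk f v, R.IsPath → AltFrom M 0 R.edges →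
        R.length % 2 = P.length % 2 → P.length ≤ R.length) →
      ∃ P' : G.Walk f v, P'.IsPath ∧ AltFrom M 0 P'.edges ∧ P'.length = P.length ∧
        ∀ e ∈ P'.edges, e ∈ (graphAt T G M f k).edgeSet := by
  induction n using Nat.strong_induction_on with
  | _ n ih =>
  intro hn v P hP hPM hPn hmin
  have key : ∀ (w : V) (A : G.Walk f w) (B : G.Walk w v), P = A.append B →
      (∀ e ∈ B.edges, e ∈ (graphAt T G M f k).edgeSet) →
      ∃ P' : G.Walk f v, P'.IsPath ∧ AltFrom M 0 P'.edges ∧ P'.length = P.length ∧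
        ∀ e ∈ P'.edges, e ∈ (graphAt T G M f k).edgeSet := by
    intro w A
    induction A using Walk.concatRec with
    | Hnil =>
      rintro B rfl hB
      exact ⟨_, hP, hPM, rfl, by simpa using hB⟩
    | @Hconcat f u w A hadj ihA =>
      intro B hPeq hB
      by_cases hE : (graphAt T G M f k).Adj u w
      · refine ihA hf habt ih P hP hPM hPn hmin (Walk.cons hadj B) ?_ ?_
        · rw [hPeq, Walk.concat_append]
        · intro e he
          rw [Walk.edges_cons, List.mem_cons] at he
          rcases he with rfl | he
          · exact hE
          · exact hB e he
      · subst hPeq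
        have hlen : (A.concat hadj).length = A.length + 1 := Walk.length_concat _ _
        have hlen' := Walk.length_append (A.concat hadj) B
        have hA' := hP.of_append_left
        have hA'M : AltFrom M 0 (A.concat hadj).edges := by
          rw [Walk.edges_append] at hPM
          exact hPM.left
        have hA : A.IsPath := by
          rw [Walk.concat_eq_append] at hA'
          exact hA'.of_append_left
        have hAM : AltFrom M 0 A.edges := by
          rw [Walk.edges_concat, List.concat_eq_append] at hA'M
          exact hA'M.left
        have hwf : w ≠ f := by
          rintro rfl
          have := Walk.length_eq_zero_iff.2 (Walk.isPath_iff_nil.1 hA')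
          omega
        have hlt := lt_rAlt_of_not_adj_graphAt (t := A.length % 2) hadj hwf (by omega)
          hA'M.mem_of_concat
          ((rAlt_le ((isAltPath_iff hf A).2 ⟨hA, hAM⟩) rfl).trans
            (by exact_mod_cast (by omega : A.length ≤ k))) hE
        have hpar : 1 - (A.concat hadj).length % 2 = A.length % 2 := by omega
        obtain ⟨Q, hQ, hQM, hQle, hQpar, hQE⟩ := exists_walk_through_parent hf habt hn
          (fun m hm => ih m hm (by omega)) hwf hA' hA'M (by omega) (by rwa [hpar])
        have hQB : (Q.append B).IsPath := by
          refine isPath_append_of_shortest hP hPM hQ hQM hQle hmin ?_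
          intro R hR hRM hRpar
          have hle := rAlt_le ((isAltPath_iff hf R).2 ⟨hR, hRM⟩) rfl
          rw [show R.length % 2 = A.length % 2 by omega] at hle
          have : k < R.length := by exact_mod_cast hlt.trans_le hle
          omega
        have hQBM : AltFrom M 0 (Q.append B).edges := by
          rw [Walk.edges_append] at hPM ⊢
          refine hQM.append (hPM.right.congr_mod ?_)
          simp only [Walk.length_edges]
          omega
        have hQl := Walk.length_append Q B
        refine ⟨Q.append B, hQB, hQBM, ?_, ?_⟩
        · have := hmin _ hQB hQBM (by omega)
          omega
        · intro e he
          rw [Walk.edges_append, List.mem_append] at he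
          exact he.elim (hQE e) (hB e)
  exact key v P Walk.nil (Walk.append_nil P).symm (by simp)

/-- Shortest alternating distances of value at most `k+1` are preserved in `G_k`:
`r^θ_{G_k}(f,v) = r^θ_G(f,v)` whenever `r^θ_G(f,v) ≤ k+1`. -/
theorem statement6 {V : Type*} [Fintype V] (G : SimpleGraph V) (M : Set (Sym2 V))
    (hM : IsMatching G M) (f : V) (hf : ¬ Matched M f)
    (hreach : ∀ x, ThetaReach G M 0 f x ∨ ThetaReach G M 1 f x)
    (T : SimpleGraph V) (par : V → V) (habt : AltBaseTree G M f T par)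
    (k θ : ℕ) (hθ : θ ≤ 1) (v : V)
    (hv : rAlt G M θ f v ≤ ((k + 1 : ℕ) : ℕ∞)) :
    rAlt (graphAt T G M f k) M θ f v = rAlt G M θ f v := by
  refine le_antisymm ?_ (rAlt_anti (graphAt_le habt.le))
  obtain ⟨p, hp, hpθ, hpl⟩ :=
    exists_walk_of_rAlt_ne_top (ne_top_of_le_ne_top (ENat.natCast_ne_top _) hv)
  rw [isAltPath_iff hf] at hp
  obtain ⟨q, hq, hqM, hql, hqE⟩ := exists_shortest_in_graphAt hf habt (k := k) p.length
    (by rw [← hpl] at hv; exact_mod_cast hv) v p hp.1 hp.2 rfl (by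
      intro R hR hRM hRpar
      have := rAlt_le ((isAltPath_iff hf R).2 ⟨hR, hRM⟩) rfl
      rw [hRpar, hpθ, ← hpl] at this
      exact_mod_cast this)
  rw [← hpl, ← hql, ← Walk.length_transfer q hqE]
  refine rAlt_le ⟨hq.transfer hqE, ?_⟩ (by rw [Walk.length_transfer, hql, hpθ])
  rw [Walk.edges_transfer]
  exact hqM.altList

end MM
end

section
/- Let G be a finite simple graph with n nodes, M a matching of G, and f an unmatched node such that every node of G is 0-reachable or 1-reachable from f in G. Then there exists a spanning subgraph H of G with at most 2(n−1) edges such that for every node v and every θ ∈ {0,1}, if v is θ-reachable from f in G then v is θ-reachable from f in H (a sparse certificate). -/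
namespace MM

open SimpleGraph

variable {V : Type*}

/-- `m` is (the partner involution of) a matching of `H` whose uncovered nodes are exactly `S`. -/
def IsPartner (H : SimpleGraph V) (m : V → V) (S : Set V) : Prop :=
  (∀ w, m (m w) = w) ∧ (∀ w, m w ≠ w → H.Adj w (m w)) ∧ ∀ w, m w = w ↔ w ∈ S

theorem IsPartner.mono {H K : SimpleGraph V} {m : V → V} {S : Set V} (h : IsPartner H m S)
    (hHK : H ≤ K) : IsPartner K m S :=
  ⟨h.1, fun w hw => hHK (h.2.1 w hw), h.2.2⟩

open Classical in
/-- Replace the edge `y z` by `t y`. -/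
noncomputable def rotate (m : V → V) (t y z : V) : V → V :=
  fun w => if w = t then y else if w = y then t else if w = z then z else m w

open Classical in
/-- Make both `x` and `y` uncovered. -/
noncomputable def removeEdge (m : V → V) (x y : V) : V → V :=
  fun w => if w = x then x else if w = y then y else m w

open Classical in
/-- Match `x` with `y`. -/
noncomputable def insertEdge (m : V → V) (x y : V) : V → V :=
  fun w => if w = x then y else if w = y then x else m w

theorem IsPartner.rotate {H : SimpleGraph V} {m : V → V} {S : Set V} (h : IsPartner H m S)
    {t y z : V} (ht : t ∈ S) (hyz : m y = z) (hne : z ≠ y) (hadj : H.Adj t y) :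
    IsPartner H (rotate m t y z) (insert z (S \ {t})) := by
  obtain ⟨h1, h2, h3⟩ := h
  have hty := hadj.ne
  have hmt := (h3 t).2 ht
  have hmz : m z = y := by rw [← hyz, h1]
  have hzt : z ≠ t := by grind
  refine ⟨fun w => ?_, fun w hw => ?_, fun w => ?_⟩
  · have := h1 w
    grind [MM.rotate]
  · have := h2 w
    have := hadj.symm
    grind [MM.rotate]
  · have := h3 w
    have := h3 y
    simp only [Set.mem_insert_iff, Set.mem_sdiff, Set.mem_singleton_iff]
    grind [MM.rotate]

theorem IsPartner.removeEdge {H : SimpleGraph V} {m : V → V} {S : Set V} (h : IsPartner H m S)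
    {x y : V} (hxy : m x = y) :
    IsPartner H (removeEdge m x y) (insert x (insert y S)) := by
  obtain ⟨h1, h2, h3⟩ := h
  have hyx : m y = x := by rw [← hxy, h1]
  refine ⟨fun w => ?_, fun w hw => ?_, fun w => ?_⟩
  · have := h1 w
    grind [MM.removeEdge]
  · have := h2 w
    grind [MM.removeEdge]
  · have := h3 w
    simp only [Set.mem_insert_iff]
    grind [MM.removeEdge]

theorem IsPartner.insertEdge {H : SimpleGraph V} {m : V → V} {S : Set V} (h : IsPartner H m S)
    {x y : V} (hx : x ∈ S) (hy : y ∈ S) (hadj : H.Adj x y) :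
    IsPartner H (insertEdge m x y) (S \ {x, y}) := by
  obtain ⟨h1, h2, h3⟩ := h
  have hxy := hadj.ne
  have hmx := (h3 x).2 hx
  have hmy := (h3 y).2 hy
  refine ⟨fun w => ?_, fun w hw => ?_, fun w => ?_⟩
  · have := h1 w
    grind [MM.insertEdge]
  · have := h2 w
    have := hadj.symm
    grind [MM.insertEdge]
  · have := h3 w
    simp only [Set.mem_sdiff, Set.mem_insert_iff, Set.mem_singleton_iff]
    grind [MM.insertEdge]

/-- Exchange along the component of `t` in the symmetric difference of two matchings. -/
theorem exists_exchange [Finite V] {H : SimpleGraph V} {N N' : V → V} {U B : Set V} {t : V}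
    (hN : IsPartner H N (insert t U)) (hN' : IsPartner H N' B) (hUB : U ⊆ B) (ht : t ∉ B) :
    ∃ a ∈ B \ U, ∃ X Y : V → V, IsPartner H X (insert a U) ∧
      IsPartner H Y (insert t (B \ {a})) ∧ (∀ w, X w = N w ∨ X w = N' w) ∧
      (∀ w, Y w = N w ∨ Y w = N' w) ∧ X t = N' t := by
  induction hk : {w | N w ≠ N' w}.ncard using Nat.strong_induction_on generalizing N t with
  | _ k ih =>
  have htU : t ∉ U := fun h => ht (hUB h)
  obtain ⟨n1, n2, n3⟩ := hN
  obtain ⟨p1, p2, p3⟩ := hN'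
  obtain ⟨y, hy⟩ : ∃ y, N' t = y := ⟨_, rfl⟩
  obtain ⟨z, hz⟩ : ∃ z, N y = z := ⟨_, rfl⟩
  have hyt : y ≠ t := fun h => ht ((p3 t).1 (hy.trans h))
  have hNt : N t = t := (n3 t).2 (Set.mem_insert _ _)
  have hN'y : N' y = t := by rw [← hy, p1]
  have hNz : N z = y := by rw [← hz, n1]
  have hyB : y ∉ B := fun h => hyt (((p3 y).2 h).symm.trans hN'y)
  have hzy : z ≠ y := by
    intro h
    rcases (n3 y).1 (hz.trans h) with h' | h'
    · exact hyt h'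
    · exact hyB (hUB h')
  have hzt : z ≠ t := by grind
  have hzU : z ∉ U := fun h => hzy (((n3 z).2 (Or.inr h)).symm.trans hNz)
  have hadj : H.Adj t y := by simpa [hy] using p2 t (by simpa [hy] using hyt)
  have hadj' : H.Adj z y := by simpa [hNz] using n2 z (by simpa [hNz] using hzy.symm)
  have hN2 : IsPartner H (rotate N t y z) (insert z U) := by
    have := IsPartner.rotate (m := N) ⟨n1, n2, n3⟩ (Set.mem_insert t U) hz hzy hadj
    rwa [Set.insert_sdiff_of_mem _ (Set.mem_singleton t), Set.sdiff_singleton_eq_self htU] at this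
  by_cases hzB : z ∈ B
  · have hN'z : N' z = z := (p3 z).2 hzB
    refine ⟨z, ⟨hzB, hzU⟩, MM.rotate N t y z, MM.rotate N' z y t, hN2,
      IsPartner.rotate ⟨p1, p2, p3⟩ hzB hN'y hyt.symm hadj', fun w => ?_, fun w => ?_, ?_⟩
    · clear ih n1 n2 n3 p1 p2 p3
      grind [MM.rotate]
    · clear ih n1 n2 n3 p1 p2 p3
      grind [MM.rotate]
    · simp [MM.rotate, hy]
  · have hlt : {w | rotate N t y z w ≠ N' w}.ncard < k := by
      rw [← hk]
      refine Set.ncard_lt_ncard ⟨fun w hw => ?_, fun hsub => ?_⟩ (Set.toFinite _)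
      · simp only [Set.mem_ofPred_eq] at hw ⊢
        grind [rotate]
      · have : t ∈ {w | rotate N t y z w ≠ N' w} := hsub (by grind)
        grind [rotate]
    obtain ⟨a, ha, X, Y, hX, hY, hXw, hYw, hXz⟩ := ih _ hlt hN2 hzB rfl
    have hYy : Y y = t := by
      have := hYw y
      grind [rotate]
    refine ⟨a, ha, X, rotate Y z y t, hX, ?_, fun w => ?_, fun w => ?_, ?_⟩
    · have := hY.rotate (Set.mem_insert _ _) hYy hyt.symm hadj'
      rwa [Set.insert_sdiff_of_mem _ (Set.mem_singleton z),
        Set.sdiff_singleton_eq_self (fun h => hzB h.1)] at this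
    · have := hXw w
      clear ih hXw hYw n1 n2 n3 p1 p2 p3 hk hlt hX hY hN2 ha hUB
      grind [rotate]
    · have := hYw w
      clear ih hXw hYw n1 n2 n3 p1 p2 p3 hk hlt hX hY hN2 ha hUB
      grind [rotate]
    · have := hXw t
      clear ih hXw hYw n1 n2 n3 p1 p2 p3 hk hlt hX hY hN2 ha hUB
      grind [rotate]

/-- Nodes outside `U` that can be the only uncovered node outside `U` of a matching of `H`
avoiding `U`. -/
def missable (H : SimpleGraph V) (U : Set V) : Set V :=
  {v | v ∉ U ∧ ∃ N, IsPartner H N (insert v U)}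

theorem missable_mono {H K : SimpleGraph V} {U : Set V} (h : H ≤ K) :
    missable H U ⊆ missable K U :=
  fun _ ⟨hv, N, hN⟩ => ⟨hv, N, hN.mono h⟩

/-- `x` and `y` coincide, or joining them by an edge makes no further node missable. -/
def Linked (H : SimpleGraph V) (U : Set V) (x y : V) : Prop :=
  x = y ∨ ∀ v, v ∉ missable H U → v ∉ U →
    ¬ ∃ N, IsPartner H N (insert x (insert y (insert v U)))

theorem Linked.symm {H : SimpleGraph V} {U : Set V} {x y : V} (h : Linked H U x y) :
    Linked H U y x := by
  rcases h with h | h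
  · exact Or.inl h.symm
  · refine Or.inr fun v hv hvU hN => h v hv hvU ?_
    rwa [Set.insert_comm]

theorem Linked.trans [Finite V] {H : SimpleGraph V} {U : Set V} {x t y : V}
    (hx : x ∈ missable H U) (ht : t ∈ missable H U) (hy : y ∈ missable H U)
    (hxt : Linked H U x t) (hty : Linked H U t y) : Linked H U x y := by
  rcases hxt with rfl | hxt'
  · exact hty
  rcases hty with rfl | hty'
  · exact Or.inr hxt'
  by_cases hxy : x = y
  · exact Or.inl hxy
  by_cases htx : t = x
  · subst htx; exact Or.inr hty'
  by_cases hty : t = y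
  · subst hty; exact Or.inr hxt'
  refine Or.inr fun v hv hvU ⟨N', hN'⟩ => ?_
  obtain ⟨htU, N, hN⟩ := ht
  have htv : t ≠ v := by rintro rfl; exact hv ⟨htU, N, hN⟩
  have hxv : x ≠ v := by rintro rfl; exact hv hx
  have hyv : y ≠ v := by rintro rfl; exact hv hy
  have hxU := hx.1
  have hyU := hy.1
  obtain ⟨a, ⟨haB, haU⟩, X, Y, hX, hY, -⟩ := exists_exchange hN hN'
    (fun w hw => by simp [hw]) (by simp [htx, hty, htv, htU])
  rcases haB with rfl | rfl | rfl | h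
  · refine hty' v hv hvU ⟨Y, ?_⟩
    convert hY using 1
    ext w
    simp only [Set.mem_insert_iff, Set.mem_sdiff, Set.mem_singleton_iff]
    grind
  · refine hxt' v hv hvU ⟨Y, ?_⟩
    convert hY using 1
    ext w
    simp only [Set.mem_insert_iff, Set.mem_sdiff, Set.mem_singleton_iff]
    grind
  · exact hv ⟨hvU, X, hX⟩
  · exact haU h

/-- Distinct missable nodes without a missable partner are not linked. -/
theorem not_linked_of_base [Finite V] {H : SimpleGraph V} {U : Set V} {f : V} {m : V → V}
    (hm : IsPartner H m (insert f U)) {x y : V}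
    (hx : x ∈ missable H U) (hy : y ∈ missable H U) (hxy : x ≠ y)
    (hbx : m x = x ∨ m x ∉ missable H U) (hby : m y = y ∨ m y ∉ missable H U) :
    ¬ Linked H U x y := by
  obtain ⟨hxU, N, hN⟩ := hx
  induction hk : {w | N w ≠ m w}.ncard using Nat.strong_induction_on generalizing N x y with
  | _ k ih =>
  have hfree : ∀ w, w ∉ U → w ≠ f → m w ≠ w := fun w hw hwf h => by
    rcases (hm.2.2 w).1 h with h | h
    exacts [hwf h, hw h]
  have hmU : ∀ w, w ∉ U → m w ∉ U := fun w hw h => by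
    have h1 := (hm.2.2 (m w)).2 (Or.inr h)
    rw [hm.1] at h1
    exact hw (h1 ▸ h)
  have hyU := hy.1
  intro hL
  have h := hL.resolve_left hxy
  by_cases hyf : y = f
  · have hmx : m x ≠ x := hfree x hxU fun h => hxy (h.trans hyf.symm)
    refine h (m x) (hbx.resolve_left hmx) (hmU x hxU) ⟨removeEdge m x (m x), ?_⟩
    have := hm.removeEdge (x := x) rfl
    rwa [Set.insert_comm (m x), ← hyf] at this
  have hmy : m y ≠ y := hfree y hyU hyf
  have hv := hby.resolve_left hmy
  have hvU := hmU y hyU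
  specialize h (m y) hv hvU
  by_cases hxf : x = f
  · refine h ⟨removeEdge m y (m y), ?_⟩
    have := hm.removeEdge (x := y) rfl
    rwa [Set.insert_comm (m y), Set.insert_comm y, ← hxf] at this
  by_cases hNy : N y = m y
  · refine h ⟨removeEdge N y (m y), ?_⟩
    have := hN.removeEdge hNy
    rwa [Set.insert_comm (m y), Set.insert_comm y] at this
  have hxv : x ≠ m y := by intro h'; exact hv (h' ▸ ⟨hxU, N, hN⟩)
  obtain ⟨a, ⟨haB, haU⟩, X, Y, hX, hY, hXw, -, hXx⟩ := exists_exchange hN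
    (hm.removeEdge (x := y) rfl) (fun w hw => by simp [hw]) (by simp [hxy, hxv, hxf, hxU])
  rcases haB with rfl | rfl | rfl | h'
  · have hmm := hm.1 a
    have hNN := hN.1
    have hNx : N x = x := (hN.2.2 x).2 (Set.mem_insert _ _)
    have hmx := hfree x hxU hxf
    refine ih _ ?_ ⟨hxU, N, hN⟩ hxy.symm hby hbx hyU X hX rfl hL.symm
    rw [← hk]
    refine Set.ncard_lt_ncard ⟨fun w hw => ?_, fun hsub => ?_⟩ (Set.toFinite _)
    · have := hXw w
      have := hNN w
      simp only [Set.mem_ofPred_eq] at hw ⊢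
      grind [removeEdge]
    · have : x ∈ {w | X w ≠ m w} := hsub (by grind)
      grind [removeEdge]
  · exact hv ⟨hvU, X, hX⟩
  · refine h ⟨Y, ?_⟩
    convert hY using 1
    ext w
    have := hm.2.2 a
    have := hm.1 y
    simp only [Set.mem_insert_iff, Set.mem_sdiff, Set.mem_singleton_iff]
    grind
  · exact haU h'

theorem altList_iff_isChain {M : Set (Sym2 V)} {l : List (Sym2 V)} :
    AltList M l ↔ l.IsChain fun a b => a ∈ M ↔ b ∉ M := by
  rw [List.isChain_iff_getElem]
  rfl

theorem isAltPath_concat {G : SimpleGraph V} {M : Set (Sym2 V)} {u v w : V} {p : G.Walk u v}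
    {h : G.Adj v w} : IsAltPath M (p.concat h) ↔ IsAltPath M p ∧ w ∉ p.support ∧
      ∀ e ∈ p.edges.getLast?, (e ∈ M ↔ s(v, w) ∉ M) := by
  simp only [IsAltPath, Walk.concat_isPath_iff, altList_iff_isChain, Walk.edges_concat,
    List.concat_eq_append, List.isChain_append, List.isChain_singleton, List.head?_cons,
    Option.mem_some_iff, forall_eq', true_and]
  tauto

/-- A matching missing `t` yields alternating paths from `f` to `t` and to the partner of `t`. -/
theorem exists_isAltPath [Finite V] {H : SimpleGraph V} {M : Set (Sym2 V)} {U : Set V} {f : V}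
    {m : V → V} (hmM : ∀ v w, s(v, w) ∈ M ↔ v ≠ w ∧ m v = w) (hm : IsPartner H m (insert f U))
    {t : V} {N : V → V} (htU : t ∉ U) (hN : IsPartner H N (insert t U)) :
    (∃ p : H.Walk f t, IsAltPath M p ∧ p.length % 2 = 0 ∧ (∀ e ∈ p.edges.getLast?, e ∈ M) ∧
      ∀ w ∈ p.support, w = f ∨ N w ≠ m w) ∧
    (t ≠ f → ∃ q : H.Walk f (m t), IsAltPath M q ∧ q.length % 2 = 1) := by
  induction hk : {w | N w ≠ m w}.ncard using Nat.strong_induction_on generalizing N t with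
  | _ k ih =>
  by_cases htf : t = f
  · subst htf
    refine ⟨⟨Walk.nil, ⟨Walk.IsPath.nil, ?_⟩, rfl, by simp, by simp⟩, fun h => (h rfl).elim⟩
    simp [altList_iff_isChain]
  obtain ⟨n1, n2, n3⟩ := id hN
  obtain ⟨m1, m2, m3⟩ := id hm
  obtain ⟨y, hy⟩ : ∃ y, m t = y := ⟨_, rfl⟩
  obtain ⟨z, hz⟩ : ∃ z, N y = z := ⟨_, rfl⟩
  have hyt : y ≠ t := fun h => ((m3 t).1 (hy.trans h)).elim htf htU
  have hNt : N t = t := (n3 t).2 (Set.mem_insert _ _)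
  have hmy : m y = t := by rw [← hy, m1]
  have hNz : N z = y := by rw [← hz, n1]
  have hyU : y ∉ U := fun h => hyt (((m3 y).2 (Or.inr h)).symm.trans hmy)
  have hyf : y ≠ f := by
    rintro rfl
    exact hyt (((m3 y).2 (Or.inl rfl)).symm.trans hmy)
  have hzy : z ≠ y := fun h => ((n3 y).1 (hz.trans h)).elim hyt hyU
  have hzt : z ≠ t := by grind
  have hzU : z ∉ U := fun h => hzy (((n3 z).2 (Or.inr h)).symm.trans hNz)
  have hadj : H.Adj t y := by simpa [hy] using m2 t (by simpa [hy] using hyt)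
  have hadj' : H.Adj z y := by simpa [hNz] using n2 z (by simpa [hNz] using hzy.symm)
  have hN2 : IsPartner H (MM.rotate N t y z) (insert z U) := by
    have := hN.rotate (Set.mem_insert t U) hz hzy hadj
    rwa [Set.insert_sdiff_of_mem _ (Set.mem_singleton t), Set.sdiff_singleton_eq_self htU] at this
  have hdis : ∀ w, MM.rotate N t y z w ≠ m w → N w ≠ m w ∧ w ≠ t ∧ w ≠ y := by
    intro w
    have := m1 w
    clear ih n1 n2 n3 m1 m2 m3 hk hN2 hN hm
    grind [MM.rotate]
  have hlt : {w | MM.rotate N t y z w ≠ m w}.ncard < k := by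
    rw [← hk]
    refine Set.ncard_lt_ncard ⟨fun w hw => (hdis w hw).1, fun hsub => ?_⟩ (Set.toFinite _)
    exact (hdis t (hsub (show N t ≠ m t by rw [hNt, hy]; exact hyt.symm))).2.1 rfl
  obtain ⟨⟨p, hp, hpe, hpl, hps⟩, -⟩ := ih _ hlt hzU hN2 rfl
  have hzyM : s(z, y) ∉ M := fun h => hzt <| by
    rw [← m1 z, ((hmM z y).1 h).2, hmy]
  have hytM : s(y, t) ∈ M := (hmM y t).2 ⟨hyt, hmy⟩
  have hyp : y ∉ p.support := fun h => (hps y h).elim hyf fun h => (hdis y h).2.2 rfl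
  have htp : t ∉ p.support := fun h => (hps t h).elim htf fun h => (hdis t h).2.1 rfl
  have hq : IsAltPath M (p.concat hadj') :=
    isAltPath_concat.2 ⟨hp, hyp, fun e he => by simp [hpl e he, hzyM]⟩
  refine ⟨⟨(p.concat hadj').concat hadj.symm, isAltPath_concat.2 ⟨hq, ?_, ?_⟩, ?_, ?_, ?_⟩,
    fun _ => hy ▸ ⟨p.concat hadj', hq, ?_⟩⟩
  · simp [Walk.support_concat, htp, hyt.symm]
  · simp [Walk.edges_concat, hzyM, hytM]
  · simp only [Walk.length_concat]; omega
  · simp [Walk.edges_concat, hytM]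
  · intro w hw
    simp only [Walk.support_concat, List.mem_append, List.mem_singleton] at hw
    rcases hw with (hw | rfl) | rfl
    · exact (hps w hw).imp_right fun h => (hdis w h).1
    · right; rw [hz, hmy]; exact hzt
    · right; rw [hNt, hy]; exact hyt.symm
  · simp only [Walk.length_concat]; omega

theorem linked_of_saturated {H : SimpleGraph V} {U : Set V} {x y : V} (hxy : x ≠ y)
    (hsat : missable (H ⊔ edge x y) U = missable H U)
    (hx : x ∈ missable H U) (hy : y ∈ missable H U) : Linked H U x y := by
  refine Or.inr fun v hv hvU ⟨N, hN⟩ => hv (hsat ▸ ⟨hvU, insertEdge N x y, ?_⟩)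
  have hadj : (H ⊔ edge x y).Adj x y := Or.inr ((edge_adj x y x y).2 ⟨by simp, hxy⟩)
  convert (hN.mono le_sup_left).insertEdge (by simp) (by simp) hadj using 1
  ext w
  have : x ∉ U := hx.1
  have : y ∉ U := hy.1
  have : x ≠ v := by rintro rfl; exact hv hx
  have : y ≠ v := by rintro rfl; exact hv hy
  simp only [Set.mem_insert_iff, Set.mem_sdiff, Set.mem_singleton_iff]
  grind

theorem partner_missable_of_saturated [Finite V] {H : SimpleGraph V} {U : Set V} {f : V}
    {m : V → V} (hm : IsPartner H m (insert f U)) (hfU : f ∉ U) {x y : V}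
    (hsat : missable (H ⊔ edge x y) U = missable H U)
    (hx : x ∈ missable H U) (hy : y ∉ missable H U) (hyU : y ∉ U) : m y ∈ missable H U := by
  by_contra hmy
  have hyf : y ≠ f := by rintro rfl; exact hy ⟨hfU, m, hm⟩
  have hne : m y ≠ y := fun h => ((hm.2.2 y).1 h).elim hyf hyU
  have hmyU : m y ∉ U := fun h => by
    have := (hm.2.2 (m y)).2 (Or.inr h)
    rw [hm.1] at this
    exact hne this.symm
  have hxy : x ≠ y := by rintro rfl; exact hy hx
  have hxmy : x ≠ m y := by intro h; exact hmy (h ▸ hx)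
  have hxU := hx.1
  obtain ⟨N, hN⟩ : ∃ N, IsPartner H N (insert x (insert y (insert (m y) U))) := by
    by_cases hxf : x = f
    · refine ⟨removeEdge m y (m y), ?_⟩
      have := hm.removeEdge (x := y) rfl
      rwa [Set.insert_comm (m y), Set.insert_comm y, ← hxf] at this
    obtain ⟨-, N, hN⟩ := hx
    obtain ⟨a, ⟨haB, haU⟩, X, Y, hX, hY, -⟩ := exists_exchange hN
      (hm.removeEdge (x := y) rfl) (fun w hw => by simp [hw]) (by simp [hxy, hxmy, hxf, hxU])
    rcases haB with rfl | rfl | rfl | h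
    · exact (hy ⟨hyU, X, hX⟩).elim
    · exact (hmy ⟨hmyU, X, hX⟩).elim
    · refine ⟨Y, ?_⟩
      have hmya : m y ≠ a := by
        intro h
        have := (hm.2.2 a).2 (Or.inl rfl)
        rw [← h, hm.1] at this
        exact hne this.symm
      convert hY using 1
      ext w
      simp only [Set.mem_insert_iff, Set.mem_sdiff, Set.mem_singleton_iff]
      grind
    · exact (haU h).elim
  refine hmy (hsat ▸ ⟨hmyU, insertEdge N x y, ?_⟩)
  have hadj : (H ⊔ edge x y).Adj x y := Or.inr ((edge_adj x y x y).2 ⟨by simp, hxy⟩)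
  convert (hN.mono le_sup_left).insertEdge (by simp) (by simp) hadj using 1
  ext w
  simp only [Set.mem_insert_iff, Set.mem_sdiff, Set.mem_singleton_iff]
  grind

/-- If no edge of `G` makes a further node missable, alternating paths of `G` starting at `f` only
reach nodes with the parity predicted by `missable H U`. -/
theorem missable_of_isAltPath [Finite V] {G H : SimpleGraph V} {M : Set (Sym2 V)} {U : Set V}
    {f : V} {m : V → V} (hmM : ∀ v w, s(v, w) ∈ M ↔ v ≠ w ∧ m v = w)
    (hm : IsPartner H m (insert f U)) (hfU : f ∉ U)
    (hsat : ∀ x y, G.Adj x y → missable (H ⊔ edge x y) U = missable H U)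
    {v : V} (p : G.Walk f v) (hp : IsAltPath M p) :
    (p.length % 2 = 0 ∧ v ∈ missable H U ∧ (∀ e ∈ p.edges.getLast?, e ∈ M) ∧
      ∃ b ∈ p.support, b ∈ missable H U ∧ (m b = b ∨ m b ∉ missable H U) ∧ Linked H U b v) ∨
    (p.length % 2 = 1 ∧ (∀ e ∈ p.edges.getLast?, e ∉ M) ∧ v ∉ missable H U ∧
      ((v ∈ U ∧ ∃ x ∈ missable H U, G.Adj x v) ∨ m v ∈ missable H U)) ∨
    (p.length % 2 = 1 ∧ (∀ e ∈ p.edges.getLast?, e ∉ M) ∧ v ∈ missable H U ∧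
      m v ≠ v ∧ m v ∈ missable H U ∧
      ∃ b ∈ p.support, b ∈ missable H U ∧ (m b = b ∨ m b ∉ missable H U) ∧ Linked H U b v) := by
  induction p using Walk.concatRec with
  | Hnil =>
    rename_i f
    exact Or.inl ⟨rfl, ⟨hfU, m, hm⟩, by simp, f, by simp, ⟨hfU, m, hm⟩,
      Or.inl ((hm.2.2 f).2 (Or.inl rfl)), Or.inl rfl⟩
  | Hconcat p h ih =>
    rename_i f v y
    obtain ⟨hp', hyp, halt⟩ := isAltPath_concat.1 hp
    have hnext : p.length % 2 = 1 → (∀ e ∈ p.edges.getLast?, e ∉ M) → s(v, y) ∈ M := by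
      intro hl hM
      cases he : p.edges.getLast? with
      | none =>
        rw [List.getLast?_eq_none_iff, ← List.length_eq_zero_iff, Walk.length_edges] at he
        omega
      | some e =>
        by_contra hs
        exact hM e he ((halt e he).2 hs)
    have hsub := p.support_subset_support_concat h
    have hlast : (p.concat h).edges.getLast? = some s(v, y) := by simp [Walk.edges_concat]
    rcases ih hm hfU hp' with ⟨hl, hvD, hM, b, hb, hbD, hbb, hbv⟩ | ⟨hl, hM, hvD, hv⟩ |
      ⟨hl, hM, hvD, hmv, hmvD, b, hb, hbD, hbb, hbv⟩
    · have hs : s(v, y) ∉ M := by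
        intro hs
        cases he : p.edges.getLast? with
        | none =>
          rw [List.getLast?_eq_none_iff, ← List.length_eq_zero_iff, Walk.length_edges] at he
          obtain rfl := Walk.eq_of_length_eq_zero he
          have := (hmM _ _).1 hs
          exact this.1 (((hm.2.2 _).2 (Or.inl rfl)).symm.trans this.2)
        | some e => exact (halt e he).1 (hM e he) hs
      have hlen : (p.concat h).length % 2 = 1 := by rw [Walk.length_concat]; omega
      have hlM : ∀ e ∈ (p.concat h).edges.getLast?, e ∉ M := by simpa [hlast] using hs
      by_cases hyD : y ∈ missable H U
      · have hby := hbv.trans hbD hvD hyD (linked_of_saturated h.ne (hsat v y h) hvD hyD)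
        have hbase : ¬ (m y = y ∨ m y ∉ missable H U) := fun hyb =>
          not_linked_of_base hm hbD hyD (by rintro rfl; exact hyp hb) hbb hyb hby
        rw [not_or, not_not] at hbase
        exact Or.inr (Or.inr ⟨hlen, hlM, hyD, hbase.1, hbase.2, b, hsub hb, hbD, hbb, hby⟩)
      · refine Or.inr (Or.inl ⟨hlen, hlM, hyD, ?_⟩)
        by_cases hyU : y ∈ U
        · exact Or.inl ⟨hyU, v, hvD, h⟩
        · exact Or.inr (partner_missable_of_saturated hm hfU (hsat v y h) hvD hyD hyU)
    · have hs := hnext hl hM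
      obtain ⟨hne, hmv⟩ := (hmM _ _).1 hs
      have hyD : y ∈ missable H U := by
        rcases hv with ⟨hvU, -⟩ | hv
        · exact (hne (((hm.2.2 v).2 (Or.inr hvU)).symm.trans hmv)).elim
        · exact hmv ▸ hv
      refine Or.inl ⟨by rw [Walk.length_concat]; omega, hyD, by simpa [hlast] using hs, y,
        Walk.end_mem_support _, hyD, Or.inr ?_, Or.inl rfl⟩
      rwa [← hmv, hm.1]
    · have hs := hnext hl hM
      obtain ⟨hne, hmv⟩ := (hmM _ _).1 hs
      have hyD : y ∈ missable H U := hmv ▸ hmvD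
      exact Or.inl ⟨by rw [Walk.length_concat]; omega, hyD, by simpa [hlast] using hs, b, hsub hb,
        hbD, hbb, hbv.trans hbD hvD hyD (linked_of_saturated h.ne (hsat v y h) hvD hyD)⟩

theorem ThetaReach.mono {H K : SimpleGraph V} {M : Set (Sym2 V)} {θ : ℕ} {u v : V}
    (h : H ≤ K) : ThetaReach H M θ u v → ThetaReach K M θ u v := by
  rintro ⟨p, ⟨hp, ha⟩, hl⟩
  exact ⟨p.mapLe h, ⟨hp.mapLe h, by simpa using ha⟩, by simpa using hl⟩

/-- The partner involution of a matching. -/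
theorem IsMatching.exists_partner {G : SimpleGraph V} {M : Set (Sym2 V)} (hM : IsMatching G M) :
    ∃ m : V → V, (∀ v, m (m v) = v) ∧ ∀ v w, s(v, w) ∈ M ↔ v ≠ w ∧ m v = w := by
  classical
  have huniq : ∀ v w w', s(v, w) ∈ M → s(v, w') ∈ M → w = w' := fun v w w' h h' =>
    Sym2.congr_right.1 (hM.2 _ h _ h' v (by simp) (by simp))
  let m : V → V := fun v => if h : ∃ w, s(v, w) ∈ M then h.choose else v
  have hmem : ∀ v w, s(v, w) ∈ M ↔ v ≠ w ∧ m v = w := by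
    intro v w
    constructor
    · intro h
      have hex : ∃ w, s(v, w) ∈ M := ⟨w, h⟩
      refine ⟨(G.mem_edgeSet.1 (hM.1 h)).ne, ?_⟩
      simp only [m, dif_pos hex]
      exact huniq v _ _ hex.choose_spec h
    · rintro ⟨hne, h⟩
      by_cases hex : ∃ w, s(v, w) ∈ M
      · simp only [m, dif_pos hex] at h
        exact h ▸ hex.choose_spec
      · simp only [m, dif_neg hex] at h
        exact (hne h).elim
  refine ⟨m, fun v => ?_, hmem⟩
  by_cases h : m v = v
  · rw [h, h]
  · have := (hmem v (m v)).2 ⟨Ne.symm h, rfl⟩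
    rw [Sym2.eq_swap] at this
    exact ((hmem _ _).1 this).2

/-- A sparse subgraph containing the matching to which no single edge of `G` can be added so as to
make further nodes missable. -/
theorem exists_saturated [Finite V] {G K : SimpleGraph V} (hKG : K ≤ G) {U : Set V}
    (hK : (missable K U).Nonempty) :
    ∃ H, K ≤ H ∧ H ≤ G ∧ H.edgeSet.ncard + 1 ≤ K.edgeSet.ncard + (missable H U).ncard ∧
      ∀ x y, G.Adj x y → missable (H ⊔ edge x y) U = missable H U := by
  obtain ⟨H, ⟨hKH, hHG, hcard⟩, hmax⟩ := Set.Finite.exists_maximalFor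
    (fun H : SimpleGraph V => (missable H U).ncard)
    {H | K ≤ H ∧ H ≤ G ∧ H.edgeSet.ncard + 1 ≤ K.edgeSet.ncard + (missable H U).ncard}
    (Set.toFinite _)
    ⟨K, le_rfl, hKG, Nat.add_le_add_left ((Set.ncard_pos (Set.toFinite _)).2 hK) _⟩
  refine ⟨H, hKH, hHG, hcard, fun x y hxy => ?_⟩
  by_contra hne
  have hlt : (missable H U).ncard < (missable (H ⊔ edge x y) U).ncard :=
    Set.ncard_lt_ncard ((missable_mono le_sup_left).ssubset_of_ne (Ne.symm hne)) (Set.toFinite _)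
  have hedge : (H ⊔ edge x y).edgeSet.ncard ≤ H.edgeSet.ncard + 1 := by
    rw [edgeSet_sup, edgeSet_edge_of_ne hxy.ne]
    exact (Set.ncard_union_le _ _).trans (by rw [Set.ncard_singleton])
  have hmem : H ⊔ edge x y ≤ G := by
    refine sup_le hHG fun a b hab => ?_
    have := (edge_adj x y a b).1 hab
    rcases this with ⟨⟨rfl, rfl⟩ | ⟨rfl, rfl⟩, -⟩
    · exact hxy
    · exact hxy.symm
  have : (missable (H ⊔ edge x y) U).ncard ≤ (missable H U).ncard :=
    hmax ⟨hKH.trans le_sup_left, hmem, by omega⟩ hlt.le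
  omega

/-- Sparse certificate: there is a spanning subgraph `H ≤ G` with at most `2(n−1)` edges
preserving `θ`-reachability from `f` for every node and `θ ∈ {0,1}`. -/
theorem statement9 {V : Type*} [Fintype V] (G : SimpleGraph V) (M : Set (Sym2 V))
    (hM : IsMatching G M) (f : V) (hf : ¬ Matched M f)
    (hreach : ∀ v, ThetaReach G M 0 f v ∨ ThetaReach G M 1 f v) :
    ∃ H : SimpleGraph V, H ≤ G ∧ H.edgeSet.ncard ≤ 2 * (Fintype.card V - 1) ∧
      ∀ (v : V) (θ : ℕ), θ ≤ 1 → ThetaReach G M θ f v → ThetaReach H M θ f v := by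
  classical
  obtain ⟨m, hmm, hmM⟩ := hM.exists_partner
  have hmf : m f = f := by
    by_contra h
    exact hf ⟨_, (hmM f (m f)).2 ⟨Ne.symm h, rfl⟩, by simp⟩
  let U : Set V := {w | w ≠ f ∧ m w = w}
  have hfU : f ∉ U := fun h => h.1 rfl
  have hKG : fromEdgeSet M ≤ G := fun a b hab => hM.1 ((fromEdgeSet_adj M).1 hab).1
  have hmK : IsPartner (fromEdgeSet M) m (insert f U) := by
    refine ⟨hmm, fun w hw => (fromEdgeSet_adj M).2 ⟨(hmM _ _).2 ⟨hw.symm, rfl⟩, hw.symm⟩,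
      fun w => ?_⟩
    simp only [U, Set.mem_insert_iff, Set.mem_ofPred_eq]
    grind
  obtain ⟨H, hKH, hHG, hcard, hsat⟩ := exists_saturated hKG (U := U) ⟨f, hfU, m, hmK⟩
  have hmH := hmK.mono hKH
  let c : V → V := fun u => if h : ∃ x ∈ missable H U, G.Adj x u then h.choose else u
  have hc : ∀ u, (∃ x ∈ missable H U, G.Adj x u) → c u ∈ missable H U ∧ G.Adj (c u) u := by
    intro u h
    simp only [c, dif_pos h]
    exact h.choose_spec
  let P : Set (Sym2 V) := (fun u => s(c u, u)) '' U
  have hcG : fromEdgeSet P ≤ G := by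
    intro a b hab
    obtain ⟨⟨u, -, hu⟩, hne⟩ := (fromEdgeSet_adj P).1 hab
    have h : ∃ x ∈ missable H U, G.Adj x u := by
      by_contra h
      simp only [c, dif_neg h, Sym2.eq_iff] at hu
      grind
    have := G.mem_edgeSet.2 (hc u h).2
    rwa [show s(c u, u) = s(a, b) from hu, G.mem_edgeSet] at this
  refine ⟨H ⊔ fromEdgeSet P, sup_le hHG hcG, ?_, ?_⟩
  · have h1 : (H ⊔ fromEdgeSet P).edgeSet.ncard ≤ H.edgeSet.ncard + U.ncard := by
      rw [edgeSet_sup]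
      refine (Set.ncard_union_le _ _).trans (Nat.add_le_add_left ?_ _)
      have hsub : (fromEdgeSet P).edgeSet ⊆ P := by
        rw [edgeSet_fromEdgeSet]
        exact Set.sdiff_subset
      exact (Set.ncard_le_ncard hsub (Set.toFinite _)).trans (Set.ncard_image_le (Set.toFinite U))
    have h2 : (fromEdgeSet M).edgeSet.ncard + 1 ≤ Fintype.card V := by
      have hsub : (fromEdgeSet M).edgeSet ⊆ (fun v => s(v, m v)) '' ({f}ᶜ : Set V) := by
        rw [edgeSet_fromEdgeSet]
        rintro ⟨a, b⟩ ⟨he, -⟩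
        refine ⟨a, fun h => hf ⟨_, he, ?_⟩, ?_⟩
        · rw [← show a = f from h]; simp
        · simp only [((hmM a b).1 he).2]
      have h3 := (Set.ncard_le_ncard hsub (Set.toFinite _)).trans
        (Set.ncard_image_le (Set.toFinite _))
      have h4 := Set.ncard_add_ncard_compl ({f} : Set V)
      rw [Set.ncard_singleton, Nat.card_eq_fintype_card] at h4
      omega
    have h3 : (missable H U).ncard + U.ncard ≤ Fintype.card V := by
      rw [← Nat.card_eq_fintype_card, ← Set.ncard_add_ncard_compl U, add_comm]
      exact Nat.add_le_add_left (Set.ncard_le_ncard (fun v hv => hv.1) (Set.toFinite _)) _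
    omega
  · have hodd : ∀ v, m v ∈ missable H U → m v ≠ f → ThetaReach (H ⊔ fromEdgeSet P) M 1 f v := by
      rintro v ⟨hvU, N, hN⟩ hvf
      obtain ⟨q, hq, hql⟩ := (exists_isAltPath hmM hmH hvU hN).2 hvf
      have hr : ThetaReach H M 1 f (m (m v)) := ⟨q, hq, hql⟩
      rw [hmm] at hr
      exact hr.mono le_sup_left
    rintro v θ hθ ⟨p, hp, hl⟩
    rcases missable_of_isAltPath hmM hmH hfU hsat p hp with ⟨hpar, hv, -⟩ |
      ⟨hpar, -, hvD, hv⟩ | ⟨hpar, -, hv, hne, hmv, -⟩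
    · obtain rfl : θ = 0 := by omega
      obtain ⟨hvU, N, hN⟩ := hv
      obtain ⟨⟨q, hq, hql, -⟩, -⟩ := exists_isAltPath hmM hmH hvU hN
      exact ThetaReach.mono le_sup_left ⟨q, hq, hql⟩
    all_goals obtain rfl : θ = 1 := by omega
    · rcases hv with ⟨hvU, hx⟩ | hv
      · obtain ⟨⟨hxU, N, hN⟩, hadj⟩ := hc v hx
        obtain ⟨⟨q, ⟨hq, hqa⟩, hql, hqM, hqs⟩, -⟩ :=
          exists_isAltPath hmM hmH hxU hN
        have hle : H ≤ H ⊔ fromEdgeSet P := le_sup_left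
        have hadj' : (H ⊔ fromEdgeSet P).Adj (c v) v :=
          Or.inr ((fromEdgeSet_adj P).2 ⟨⟨v, hvU, rfl⟩, hadj.ne⟩)
        have hnM : s(c v, v) ∉ M := fun h => by
          rw [Sym2.eq_swap] at h
          have := (hmM _ _).1 h
          exact this.1 (hvU.2.symm.trans this.2)
        refine ⟨(q.mapLe hle).concat hadj', isAltPath_concat.2 ⟨⟨hq.mapLe hle, by simpa using hqa⟩,
          ?_, ?_⟩, ?_⟩
        · rw [Walk.support_mapLe_eq_support]
          exact fun h => (hqs v h).elim hvU.1 fun h =>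
            h (((hN.2.2 v).2 (Or.inr hvU)).trans hvU.2.symm)
        · rw [Walk.edges_mapLe_eq_edges]
          exact fun e he => by simp [hqM e he, hnM]
        · rw [Walk.length_concat, Walk.length_map]; omega
      · exact hodd v hv fun h => hvD (by rw [← hmm v, h, hmf, ← h]; exact hv)
    · exact hodd v hmv fun h => hne (by rw [h, ← hmm v, h, hmf])

end MM
end
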